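/- Let W be a nonempty word over A^{±1} and n ≥ 0 an integer. Then W is a product of at most n conjugates of words in R_2^{±1} in F(A) (where R_2 is the relator set of presentation (1.2)) if and only if there is a finite sequence Ω of elementary operations that transforms the empty pseudobracket system for W into a final pseudobracket system {(0, |W|, 0, 0, 0, n')} with n' ≤ n, such that Ω has size bounded by (11|W|, C(log|W| + 1)), where C = (log(6/5))^{-1} and log denotes the base-2 logarithm. [Lemma 4.8] -/

import Mathlib

namespace Stmt11

/-- Words over the alphabet `A^{±1}` where `A = {a_1, ..., a_m}`. -/
abbrev Word (m : ℕ) := List (Fin m × Bool)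

/-- The image of a word in the free group `F(A)`. -/
def evalW {m : ℕ} (w : Word m) : FreeGroup (Fin m) := FreeGroup.mk w

/-- The relator set `R_2 = {a_i^k : k ∈ E_i, k ≠ 0}` of presentation (1.2), as a set of
elements of the free group `F(A)`. -/
def Rel2 (m : ℕ) (E : Fin m → Set ℕ) : Set (FreeGroup (Fin m)) :=
  {g | ∃ (i : Fin m) (k : ℕ), k ∈ E i ∧ k ≠ 0 ∧ g = FreeGroup.of i ^ k}

/-- `g` is a product of exactly `n` conjugates of elements of `R ∪ R⁻¹`. -/
def IsProdConj {G : Type*} [Group G] (R : Set G) (n : ℕ) (g : G) : Prop :=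
  ∃ r s : Fin n → G,
    (∀ i, r i ∈ R ∨ (r i)⁻¹ ∈ R) ∧
    g = (List.ofFn fun i => s i * r i * (s i)⁻¹).prod

/-- A pseudobracket for presentation (1.2): the 6-tuple `(b(1), ..., b(6))`.  The third
component `c3 = j` encodes the generator index: `c3 = 0` for pseudobrackets of type PB1
and `c3 = j ∈ {1, ..., m}` (meaning the generator `a_j`) for type PB2. -/
structure PB where
  c1 : ℕ
  c2 : ℕ
  c3 : ℕ
  c4 : ℕ
  c5 : ℤ
  c6 : ℕ
deriving DecidableEq

/-- The sign `ε = ±1` of a letter. -/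
def sgn (ε : Bool) : ℤ := if ε then 1 else -1

/-- Type PB1: `b(3) = b(4) = b(5) = 0`. -/
def IsPB1 (b : PB) : Prop := b.c3 = 0 ∧ b.c4 = 0 ∧ b.c5 = 0

/-- Type PB2: `b(3) ∈ {1, ..., m}`, `b(4) ∈ E_{b(3)}`, `0 < b(4) ≤ |W|`,
`-b(4) < b(5) < b(4)`. -/
def IsPB2 (m : ℕ) (E : Fin m → Set ℕ) (W : Word m) (b : PB) : Prop :=
  ∃ i : Fin m, b.c3 = (i : ℕ) + 1 ∧ b.c4 ∈ E i ∧ 0 < b.c4 ∧ b.c4 ≤ W.length ∧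
    -(b.c4 : ℤ) < b.c5 ∧ b.c5 < (b.c4 : ℤ)

/-- A pseudobracket for the word `W`: `0 ≤ b(1) ≤ b(2) ≤ |W|`, `0 ≤ b(6) ≤ |W|`, and
`b` has type PB1 or PB2. -/
def ValidPB (m : ℕ) (E : Fin m → Set ℕ) (W : Word m) (b : PB) : Prop :=
  b.c1 ≤ b.c2 ∧ b.c2 ≤ W.length ∧ b.c6 ≤ W.length ∧ (IsPB1 b ∨ IsPB2 m E W b)

/-- A pseudobracket system for `W`: a finite set of pseudobrackets such that for
distinct `b, c` either `b(2) ≤ c(1)` or `c(2) ≤ b(1)`. -/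
def IsPBS (m : ℕ) (E : Fin m → Set ℕ) (W : Word m) (B : Finset PB) : Prop :=
  (∀ b ∈ B, ValidPB m E W b) ∧
    ∀ b ∈ B, ∀ c ∈ B, b ≠ c → b.c2 ≤ c.c1 ∨ c.c2 ≤ b.c1

/-- The elementary operations over pseudobracket systems for `W` with respect to
presentation (1.2): additions, extensions of types 1–3, turns and mergers; each
operation is required to produce again a pseudobracket system. -/
inductive Step (m : ℕ) (E : Fin m → Set ℕ) (W : Word m) :
    Finset PB → Finset PB → Prop
  | add (B : Finset PB) (v : ℕ) (hv : v ≤ W.length)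
      (hnot : (⟨v, v, 0, 0, 0, 0⟩ : PB) ∉ B)
      (hpbs : IsPBS m E W (insert (⟨v, v, 0, 0, 0, 0⟩ : PB) B)) :
      Step m E W B (insert (⟨v, v, 0, 0, 0, 0⟩ : PB) B)
  | ext1L (B : Finset PB) (b b' : PB) (hb : b ∈ B) (i : Fin m) (ε : Bool)
      (hg : b.c3 = (i : ℕ) + 1) (hl : 1 ≤ b.c1) (hlet : W[b.c1 - 1]? = some (i, ε))
      (hs : b.c5.natAbs + 2 ≤ b.c4) (hsgn : 0 ≤ sgn ε * b.c5)
      (hb' : b' = ⟨b.c1 - 1, b.c2, b.c3, b.c4, b.c5 + sgn ε, b.c6⟩)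
      (hpbs : IsPBS m E W (insert b' (B.erase b))) :
      Step m E W B (insert b' (B.erase b))
  | ext1R (B : Finset PB) (b b' : PB) (hb : b ∈ B) (i : Fin m) (ε : Bool)
      (hg : b.c3 = (i : ℕ) + 1) (hlet : W[b.c2]? = some (i, ε))
      (hs : b.c5.natAbs + 2 ≤ b.c4) (hsgn : 0 ≤ sgn ε * b.c5)
      (hb' : b' = ⟨b.c1, b.c2 + 1, b.c3, b.c4, b.c5 + sgn ε, b.c6⟩)
      (hpbs : IsPBS m E W (insert b' (B.erase b))) :
      Step m E W B (insert b' (B.erase b))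
  | ext2L (B : Finset PB) (b b' : PB) (hb : b ∈ B) (i : Fin m) (ε : Bool)
      (hg : b.c3 = (i : ℕ) + 1) (hl : 1 ≤ b.c1) (hlet : W[b.c1 - 1]? = some (i, ε))
      (hs : b.c5.natAbs + 1 = b.c4) (hsgn : 0 ≤ sgn ε * b.c5)
      (hb' : b' = ⟨b.c1 - 1, b.c2, 0, 0, 0, b.c6 + 1⟩)
      (hpbs : IsPBS m E W (insert b' (B.erase b))) :
      Step m E W B (insert b' (B.erase b))
  | ext2R (B : Finset PB) (b b' : PB) (hb : b ∈ B) (i : Fin m) (ε : Bool)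
      (hg : b.c3 = (i : ℕ) + 1) (hlet : W[b.c2]? = some (i, ε))
      (hs : b.c5.natAbs + 1 = b.c4) (hsgn : 0 ≤ sgn ε * b.c5)
      (hb' : b' = ⟨b.c1, b.c2 + 1, 0, 0, 0, b.c6 + 1⟩)
      (hpbs : IsPBS m E W (insert b' (B.erase b))) :
      Step m E W B (insert b' (B.erase b))
  | ext3 (B : Finset PB) (b b' : PB) (hb : b ∈ B) (hpb1 : IsPB1 b) (i : Fin m)
      (ε : Bool) (hl : 1 ≤ b.c1)
      (hlet1 : W[b.c1 - 1]? = some (i, ε)) (hlet2 : W[b.c2]? = some (i, !ε))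
      (hb' : b' = ⟨b.c1 - 1, b.c2 + 1, 0, 0, 0, b.c6⟩)
      (hpbs : IsPBS m E W (insert b' (B.erase b))) :
      Step m E W B (insert b' (B.erase b))
  | turn (B : Finset PB) (b b' : PB) (hb : b ∈ B) (hpb1 : IsPB1 b) (i : Fin m)
      (hEi : E i ≠ {0}) (k : ℕ) (hk : k ∈ E i) (hk0 : 0 < k) (hkW : k ≤ W.length)
      (hb' : b' = ⟨b.c1, b.c2, (i : ℕ) + 1, k, 0, b.c6⟩)
      (hpbs : IsPBS m E W (insert b' (B.erase b))) :
      Step m E W B (insert b' (B.erase b))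
  | merge (B : Finset PB) (b c b' : PB) (hb : b ∈ B) (hc : c ∈ B) (hbc : b ≠ c)
      (hr : b.c2 = c.c1) (h1 : IsPB1 b ∨ IsPB1 c)
      (hb' : b' = ⟨b.c1, c.c2, b.c3 + c.c3, b.c4 + c.c4, b.c5 + c.c5, b.c6 + c.c6⟩)
      (hpbs : IsPBS m E W (insert b' ((B.erase b).erase c))) :
      Step m E W B (insert b' ((B.erase b).erase c))

/-- The constant `C = (log (6/5))⁻¹` (base-2 logarithm). -/
noncomputable def Cconst : ℝ := (Real.logb 2 (6 / 5))⁻¹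

/-! ### Soundness -/

/-- Product of at most `n` conjugates. -/
inductive PC {G : Type*} [Group G] (R : Set G) : ℕ → G → Prop
  | one (n : ℕ) : PC R n 1
  | cons (n : ℕ) (r s g : G) (hr : r ∈ R ∨ r⁻¹ ∈ R) (h : PC R n g) :
      PC R (n + 1) (s * r * s⁻¹ * g)

section PCsec
variable {G : Type*} [Group G] {R : Set G}

lemma PC.mono {n : ℕ} {g : G} (h : PC R n g) : ∀ {k : ℕ}, n ≤ k → PC R k g := by
  induction h with
  | one n => intro k _; exact PC.one k
  | cons n r s g hr h ih =>
    intro k hk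
    obtain ⟨k, rfl⟩ : ∃ k', k = k' + 1 := ⟨k - 1, by omega⟩
    exact PC.cons k r s g hr (ih (by omega))

lemma PC.mul {n k : ℕ} {g h : G} (hg : PC R n g) (hh : PC R k h) : PC R (n + k) (g * h) := by
  induction hg with
  | one n => simpa using hh.mono (by omega)
  | cons n r s g hr _ ih =>
    have := PC.cons (n + k) r s (g * h) hr ih
    rw [← mul_assoc] at this
    exact this.mono (by omega)

lemma PC.conj {n : ℕ} {g : G} (hg : PC R n g) (t : G) : PC R n (t * g * t⁻¹) := by
  induction hg with
  | one n => simpa using PC.one n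
  | cons n r s g hr _ ih =>
    have := PC.cons n r (t * s) _ hr ih
    convert this using 1
    group

lemma PC.rel {r : G} (hr : r ∈ R ∨ r⁻¹ ∈ R) : PC R 1 r := by
  simpa using PC.cons 0 r 1 1 hr (PC.one 0)

lemma PC.to {n : ℕ} {g : G} (hg : PC R n g) : ∃ k ≤ n, IsProdConj R k g := by
  induction hg with
  | one n => exact ⟨0, by omega, fun _ => 1, fun _ => 1, fun i => i.elim0, by simp⟩
  | cons n r s g hr _ ih =>
    obtain ⟨k, hk, r', s', h1, h2⟩ := ih
    refine ⟨k + 1, by omega, Fin.cons r r', Fin.cons s s', ?_, ?_⟩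
    · intro i
      refine Fin.cases ?_ ?_ i
      · simpa using hr
      · intro i; simpa using h1 i
    · rw [h2]; simp [List.ofFn_succ]

end PCsec

lemma sgn_cases (ε : Bool) : sgn ε = 1 ∨ sgn ε = -1 := by cases ε <;> simp [sgn]

lemma sgn_not (ε : Bool) : sgn (!ε) = - sgn ε := by cases ε <;> simp [sgn]

/-- The value of a prefix of `W`. -/
def pre {m : ℕ} (W : Word m) (v : ℕ) : FreeGroup (Fin m) := FreeGroup.mk (W.take v)

lemma mk_letter {m : ℕ} (i : Fin m) (ε : Bool) :
    FreeGroup.mk [(i, ε)] = FreeGroup.of i ^ (sgn ε) := by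
  cases ε
  · simp [sgn, FreeGroup.of, FreeGroup.inv_mk, FreeGroup.invRev]
  · simp [sgn, FreeGroup.of]

lemma pre_succ {m : ℕ} (W : Word m) (v : ℕ) (i : Fin m) (ε : Bool) (h : W[v]? = some (i, ε)) :
    pre W (v + 1) = pre W v * FreeGroup.of i ^ (sgn ε) := by
  rw [← mk_letter, pre, pre, FreeGroup.mul_mk, List.take_add_one, h]
  rfl

lemma pre_pred {m : ℕ} (W : Word m) (v : ℕ) (i : Fin m) (ε : Bool) (hv : 1 ≤ v)
    (h : W[v - 1]? = some (i, ε)) :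
    pre W v = pre W (v - 1) * FreeGroup.of i ^ (sgn ε) := by
  have := pre_succ W (v - 1) i ε h
  rwa [Nat.sub_add_cancel hv] at this

/-- Soundness invariant. -/
def Inv {m : ℕ} (E : Fin m → Set ℕ) (W : Word m) (b : PB) : Prop :=
  (IsPB1 b → PC (Rel2 m E) b.c6 ((pre W b.c1)⁻¹ * pre W b.c2)) ∧
  ∀ i : Fin m, b.c3 = (i : ℕ) + 1 →
    PC (Rel2 m E) b.c6 ((pre W b.c1)⁻¹ * pre W b.c2 * FreeGroup.of i ^ (-b.c5))

lemma rel_pow {m : ℕ} (E : Fin m → Set ℕ) (i : Fin m) (k : ℕ) (hk : k ∈ E i) (e : ℤ)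
    (he : e.natAbs = k) (h0 : k ≠ 0) : PC (Rel2 m E) 1 (FreeGroup.of i ^ e) := by
  apply PC.rel
  rcases Int.natAbs_eq e with h | h
  · left; exact ⟨i, k, hk, h0, by rw [h, he]; simp⟩
  · right; exact ⟨i, k, hk, h0, by rw [h, he]; simp⟩

lemma sgn_abs {ε : Bool} {c : ℤ} {k : ℕ} (hs : c.natAbs + 1 = k) (h : 0 ≤ sgn ε * c) :
    (c + sgn ε).natAbs = k := by
  rcases sgn_cases ε with h' | h' <;> rw [h'] at h ⊢ <;> omega

lemma Step.inv {m : ℕ} {E : Fin m → Set ℕ} {W : Word m} {B B' : Finset PB}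
    (h : Step m E W B B') (hB : ∀ b ∈ B, ValidPB m E W b ∧ Inv E W b) :
    ∀ b ∈ B', ValidPB m E W b ∧ Inv E W b := by
  cases h with
  | add v hv hnot hpbs =>
    intro b hb
    refine ⟨hpbs.1 b hb, ?_⟩
    rcases Finset.mem_insert.1 hb with rfl | hb
    · refine ⟨fun _ => by simpa using PC.one 0, fun i hi => by simp at hi⟩
    · exact (hB b hb).2
  | ext1L b b' hb i ε hg hl hlet hs hsgn hb' hpbs =>
    intro d hd
    refine ⟨hpbs.1 d hd, ?_⟩
    rcases Finset.mem_insert.1 hd with rfl | hd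
    · subst hb'
      refine ⟨fun h => by have := h.1; simp at this; omega, fun j hj => ?_⟩
      obtain rfl : i = j := by ext; simp at hj; omega
      have := ((hB b hb).2.2 i hg).conj (FreeGroup.of i ^ sgn ε)
      rw [pre_pred W b.c1 i ε hl hlet] at this
      convert this using 1
      simp only [neg_add, zpow_add, zpow_neg]
      group
    · exact (hB d (Finset.mem_of_mem_erase hd)).2
  | ext1R b b' hb i ε hg hlet hs hsgn hb' hpbs =>
    intro d hd
    refine ⟨hpbs.1 d hd, ?_⟩
    rcases Finset.mem_insert.1 hd with rfl | hd
    · subst hb'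
      refine ⟨fun h => by have := h.1; simp at this; omega, fun j hj => ?_⟩
      obtain rfl : i = j := by ext; simp at hj; omega
      have := ((hB b hb).2.2 i hg)
      simp only [pre_succ W b.c2 i ε hlet]
      convert this using 1
      simp only [neg_add, zpow_add, zpow_neg]
      group
    · exact (hB d (Finset.mem_of_mem_erase hd)).2
  | ext2L b b' hb i ε hg hl hlet hs hsgn hb' hpbs =>
    intro d hd
    refine ⟨hpbs.1 d hd, ?_⟩
    rcases Finset.mem_insert.1 hd with rfl | hd
    · subst hb'
      refine ⟨fun _ => ?_, fun j hj => by simp at hj⟩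
      have := ((hB b hb).2.2 i hg).conj (FreeGroup.of i ^ sgn ε)
      rw [pre_pred W b.c1 i ε hl hlet] at this
      have hE : b.c4 ∈ E i := by
        rcases (hB b hb).1.2.2.2 with h | ⟨j, h1, h2, _⟩
        · have := h.1; omega
        · obtain rfl : i = j := by ext; omega
          exact h2
      have := this.mul (rel_pow E i b.c4 hE _ (sgn_abs hs hsgn) (by omega))
      convert this using 1
      simp only [zpow_add, zpow_neg]
      group
    · exact (hB d (Finset.mem_of_mem_erase hd)).2
  | ext2R b b' hb i ε hg hlet hs hsgn hb' hpbs =>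
    intro d hd
    refine ⟨hpbs.1 d hd, ?_⟩
    rcases Finset.mem_insert.1 hd with rfl | hd
    · subst hb'
      refine ⟨fun _ => ?_, fun j hj => by simp at hj⟩
      have := ((hB b hb).2.2 i hg)
      have hE : b.c4 ∈ E i := by
        rcases (hB b hb).1.2.2.2 with h | ⟨j, h1, h2, _⟩
        · have := h.1; omega
        · obtain rfl : i = j := by ext; omega
          exact h2
      have := this.mul (rel_pow E i b.c4 hE _ (sgn_abs hs hsgn) (by omega))
      simp only [pre_succ W b.c2 i ε hlet]
      convert this using 1
      simp only [zpow_add, zpow_neg]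
      group
    · exact (hB d (Finset.mem_of_mem_erase hd)).2
  | ext3 b b' hb hpb1 i ε hl hlet1 hlet2 hb' hpbs =>
    intro d hd
    refine ⟨hpbs.1 d hd, ?_⟩
    rcases Finset.mem_insert.1 hd with rfl | hd
    · subst hb'
      refine ⟨fun _ => ?_, fun j hj => by simp at hj⟩
      have := ((hB b hb).2.1 hpb1).conj (FreeGroup.of i ^ sgn ε)
      rw [pre_pred W b.c1 i ε hl hlet1] at this
      simp only [pre_succ W b.c2 i _ hlet2, sgn_not]
      convert this using 1
      simp only [zpow_neg]
      group
    · exact (hB d (Finset.mem_of_mem_erase hd)).2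
  | turn b b' hb hpb1 i hEi k hk hk0 hkW hb' hpbs =>
    intro d hd
    refine ⟨hpbs.1 d hd, ?_⟩
    rcases Finset.mem_insert.1 hd with rfl | hd
    · subst hb'
      refine ⟨fun h => by have := h.1; simp at this, fun j hj => ?_⟩
      simpa using (hB b hb).2.1 hpb1
    · exact (hB d (Finset.mem_of_mem_erase hd)).2
  | merge b c b' hb hc hbc hr h1 hb' hpbs =>
    intro d hd
    refine ⟨hpbs.1 d hd, ?_⟩
    rcases Finset.mem_insert.1 hd with rfl | hd
    · subst hb'
      have key : ∀ g : FreeGroup (Fin m), (pre W b.c1)⁻¹ * pre W c.c2 * g =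
          ((pre W b.c1)⁻¹ * pre W b.c2) * ((pre W c.c1)⁻¹ * pre W c.c2 * g) := by
        intro g; rw [hr]; group
      refine ⟨fun h => ?_, fun j hj => ?_⟩
      · have hb1 : IsPB1 b := by
          obtain ⟨p, q, r⟩ := h
          simp only at p q r
          rcases h1 with h1 | h1
          · exact h1
          · exact ⟨by omega, by omega, by have := h1.2.2; omega⟩
        have hc1 : IsPB1 c := by
          obtain ⟨p, q, r⟩ := h
          simp only at p q r
          exact ⟨by omega, by omega, by have := hb1.2.2; omega⟩
        have := ((hB b hb).2.1 hb1).mul ((hB c hc).2.1 hc1)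
        have k1 := key 1
        simp only [mul_one] at k1
        rw [← k1] at this
        exact this
      · simp only at hj ⊢
        rcases h1 with h1 | h1
        · have := ((hB b hb).2.1 h1).mul ((hB c hc).2.2 j (by have := h1.1; omega))
          rw [← key] at this
          rw [h1.2.2, zero_add]
          exact this
        · have h2 := ((hB b hb).2.2 j (by have := h1.1; omega))
          have h3 := (((hB c hc).2.1 h1).conj (FreeGroup.of j ^ b.c5))
          have := h2.mul h3
          rw [h1.2.2, add_zero]
          convert this using 1
          rw [hr, zpow_neg]; group
    · exact (hB d (Finset.mem_of_mem_erase (Finset.mem_of_mem_erase hd))).2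

/-! ### Combinatorial structure -/

/-- `e` is a signed sum of `c` nonzero elements of `S`. -/
inductive Cost (S : Set ℕ) : ℤ → ℕ → Prop
  | zero : Cost S 0 0
  | add (e : ℤ) (c k : ℕ) (δ : Bool) (hk : k ∈ S) (h0 : k ≠ 0) (h : Cost S e c) :
      Cost S (e + sgn δ * k) (c + 1)

lemma Cost.sum {S : Set ℕ} {e f : ℤ} {c d : ℕ} (h : Cost S e c) (h' : Cost S f d) :
    Cost S (e + f) (c + d) := by
  induction h' with
  | zero => simpa using h
  | add f d k δ hk h0 _ ih =>
    have := Cost.add _ _ k δ hk h0 ih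
    rwa [add_assoc, add_assoc] at this

/-- Noncrossing block structures; state `none` means no open block, `some (i, e)` means an open
block of the generator `i` with the current exponent sum `e`. -/
inductive O {m : ℕ} (E : Fin m → Set ℕ) : Option (Fin m × ℤ) → Word m → ℕ → Prop
  | nil (n : ℕ) : O E none [] n
  | opn (i : Fin m) (ε : Bool) (w : Word m) (n : ℕ) (h : O E (some (i, sgn ε)) w n) :
      O E none ((i, ε) :: w) n
  | close (i : Fin m) (e : ℤ) (w : Word m) (n c : ℕ) (h : O E none w n) (hc : Cost (E i) e c) :
      O E (some (i, e)) w (n + c)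
  | step (i : Fin m) (e : ℤ) (ε : Bool) (u w : Word m) (p q : ℕ) (h : O E none u p)
      (h' : O E (some (i, e + sgn ε)) w q) : O E (some (i, e)) (u ++ (i, ε) :: w) (p + q)

section Osec
variable {m : ℕ} {E : Fin m → Set ℕ}

lemma O.mono {st : Option (Fin m × ℤ)} {w : Word m} {n : ℕ} (h : O E st w n) :
    ∀ {k : ℕ}, n ≤ k → O E st w k := by
  induction h with
  | nil n => intro k _; exact O.nil k
  | opn i ε w n _ ih => intro k hk; exact O.opn i ε w k (ih hk)
  | close i e w n c _ hc ih =>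
    intro k hk
    have := O.close i e w (k - c) c (ih (by omega)) hc
    rwa [show k - c + c = k by omega] at this
  | step i e ε u w p q _ _ ih1 ih2 =>
    intro k hk
    have := O.step i e ε u w (k - q) q (ih1 (by omega)) (ih2 le_rfl)
    rwa [show k - q + q = k by omega] at this

lemma O.app {st : Option (Fin m × ℤ)} {u v : Word m} {p q : ℕ} (h : O E st u p)
    (h' : O E none v q) : O E st (u ++ v) (p + q) := by
  induction h with
  | nil n => exact h'.mono (by omega)
  | opn i ε w n _ ih => exact O.opn i ε _ _ ih
  | close i e w n c _ hc ih =>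
    exact (O.close i e _ _ c ih hc).mono (by omega)
  | step i e ε u w p q _ _ ih1 ih2 =>
    rename_i h1 _
    have := O.step i e ε u _ _ _ h1 ih2
    rw [List.append_assoc]
    exact this.mono (by omega)

lemma O.prepend {i : Fin m} {e : ℤ} {u v : Word m} {p q : ℕ} (h : O E none u p)
    (h' : O E (some (i, e)) v q) : O E (some (i, e)) (u ++ v) (p + q) := by
  cases h' with
  | close _ _ _ n c h1 hc => exact (O.close i e _ _ c (h.app h1) hc).mono (by omega)
  | step _ _ ε u' w p' q' h1 h2 =>
    have := O.step i e ε _ _ _ _ (h.app h1) h2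
    rw [List.append_assoc] at this
    exact this.mono (by omega)

lemma O.shift {st : Option (Fin m × ℤ)} {w : Word m} {n : ℕ} (h : O E st w n) :
    ∀ {i : Fin m} {e f : ℤ} {c : ℕ}, st = some (i, e) → Cost (E i) f c →
      O E (some (i, e + f)) w (n + c) := by
  induction h with
  | nil n => intro i e f c h; simp at h
  | opn i ε w n _ ih => intro i e f c h; simp at h
  | close i e w n c h1 hc ih =>
    rintro _ _ f d ⟨⟩ hd
    exact (O.close i _ _ _ _ h1 (hc.sum hd)).mono (by omega)
  | step i e ε u w p q h1 _ ih1 ih2 =>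
    rintro _ _ f d ⟨⟩ hd
    have := ih2 rfl hd
    rw [add_right_comm] at this
    exact (O.step i _ ε u w _ _ h1 this).mono (by omega)

lemma O.zero {i : Fin m} {w : Word m} {n : ℕ} (h : O E (some (i, 0)) w n) : O E none w n := by
  cases h with
  | close _ _ _ n c h1 hc => exact h1.mono (by omega)
  | step _ _ ε u w p q h1 h2 =>
    rw [zero_add] at h2
    exact h1.app (O.opn _ _ _ _ h2)

lemma O.combine {st : Option (Fin m × ℤ)} {u w : Word m} {p q : ℕ} (h : O E st u p) :
    ∀ {i : Fin m} {f g : ℤ}, st = some (i, f) → O E (some (i, g)) w q →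
      O E (some (i, f + g)) (u ++ w) (p + q) := by
  induction h with
  | nil n => intro i e f h; simp at h
  | opn i ε w n _ ih => intro i e f h; simp at h
  | close i e w n c h1 hc ih =>
    rintro _ _ g ⟨⟩ hg
    have := h1.prepend (hg.shift rfl hc)
    rw [add_comm g] at this
    exact this.mono (by omega)
  | step i e ε u w p q h1 _ ih1 ih2 =>
    rintro _ _ g ⟨⟩ hg
    have := ih2 rfl hg
    rw [add_right_comm] at this
    have := O.step i _ ε u _ _ _ h1 this
    rw [List.append_assoc]
    exact this.mono (by omega)

lemma O.inv_none {i : Fin m} {ε : Bool} {w : Word m} {n : ℕ} (h : O E none ((i, ε) :: w) n) :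
    O E (some (i, sgn ε)) w n := by
  cases h with
  | opn _ _ _ _ h => exact h

lemma O.read {i : Fin m} {f : ℤ} {ε : Bool} {v : Word m} {q : ℕ}
    (h : O E (some (i, f)) ((i, ε) :: v) q) : O E (some (i, f + sgn ε)) v q := by
  generalize hw : (i, ε) :: v = w at h
  cases h with
  | close _ _ _ n c h1 hc =>
    subst hw
    have := h1.inv_none.shift rfl hc
    rwa [add_comm] at this
  | step _ _ ε' u w p q h1 h2 =>
    cases u with
    | nil =>
      simp only [List.nil_append, List.cons.injEq, Prod.mk.injEq, true_and] at hw
      obtain ⟨rfl, rfl⟩ := hw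
      exact h2.mono (by omega)
    | cons y u =>
      simp only [List.cons_append, List.cons.injEq] at hw
      obtain ⟨rfl, rfl⟩ := hw
      have h3 : O E (some (i, f)) ((i, ε') :: w) q := by
        have := O.step i f ε' [] w 0 q (O.nil 0) h2
        simpa using this
      have := h1.inv_none.combine rfl h3
      rwa [add_comm] at this

lemma O.snoc {st : Option (Fin m × ℤ)} {w : Word m} {n : ℕ} (h : O E st w n) :
    ∀ {i : Fin m} {e : ℤ} (ε : Bool), st = some (i, e) →
      O E (some (i, e - sgn ε)) (w ++ [(i, ε)]) n := by
  induction h with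
  | nil n => intro i e f h; simp at h
  | opn i ε w n _ ih => intro i e f h; simp at h
  | close i e w n c h1 hc ih =>
    rintro _ _ ε ⟨⟩
    refine O.step i _ ε w [] n c h1 ?_
    have := O.close i e [] 0 c (O.nil 0) hc
    simpa using this
  | step i e ε u w p q h1 _ ih1 ih2 =>
    rintro _ _ δ ⟨⟩
    have := ih2 δ rfl
    rw [show e + sgn ε - sgn δ = e - sgn δ + sgn ε by ring] at this
    have := O.step i _ ε u _ _ _ h1 this
    rw [List.append_assoc]
    exact this

lemma O.rot {u : Word m} {n : ℕ} : ∀ {v : Word m}, O E none (u ++ v) n → O E none (v ++ u) n := by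
  induction u with
  | nil => intro v h; simpa using h
  | cons x u ih =>
    intro v h
    obtain ⟨i, ε⟩ := x
    rw [List.cons_append] at h
    have h1 := h.inv_none.snoc ε rfl
    rw [sub_self] at h1
    have h2 := h1.zero
    rw [List.append_assoc] at h2
    have := ih h2
    simpa using this

lemma O.del {u v : Word m} {i : Fin m} {ε : Bool} {n : ℕ}
    (h : O E none (u ++ (i, ε) :: (i, !ε) :: v) n) : O E none (u ++ v) n := by
  have h1 := h.rot
  have h2 := h1.inv_none.read
  rw [sgn_not, add_neg_cancel] at h2
  exact h2.zero.rot

lemma O.ins {u v : Word m} {i : Fin m} {ε : Bool} {n : ℕ}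
    (h : O E none (u ++ v) n) : O E none (u ++ (i, ε) :: (i, !ε) :: v) n := by
  have h1 := O.close i 0 _ n 0 h.rot Cost.zero
  have h2 : O E (some (i, sgn ε)) ((i, !ε) :: (v ++ u)) n := by
    have := O.step i (sgn ε) (!ε) [] (v ++ u) 0 n (O.nil 0) (by
      rw [sgn_not, add_neg_cancel]; exact h1)
    simpa using this
  have h3 := O.opn _ _ _ _ h2
  exact O.rot (u := (i, ε) :: (i, !ε) :: v) h3

lemma O.red {u v : Word m} {n : ℕ} (h : FreeGroup.Red u v) : O E none u n ↔ O E none v n := by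
  induction h with
  | refl => rfl
  | tail _ hs ih =>
    rw [ih]
    cases hs with
    | not => exact ⟨O.del, O.ins⟩

lemma O.congr {u v : Word m} {n : ℕ} (h : FreeGroup.mk u = FreeGroup.mk v) (hu : O E none u n) :
    O E none v n := by
  obtain ⟨w, h1, h2⟩ := FreeGroup.Red.exact.1 h
  exact (O.red h2).2 ((O.red h1).1 hu)

lemma O.conj {s w t : Word m} {n : ℕ} (h : FreeGroup.mk t = (FreeGroup.mk s)⁻¹)
    (hw : O E none w n) : O E none (s ++ w ++ t) n := by
  have : O E none (t ++ (s ++ w)) n := by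
    refine O.congr ?_ hw
    rw [← FreeGroup.mul_mk, ← FreeGroup.mul_mk, h]
    group
  exact this.rot

lemma O.replicate {i : Fin m} {ε : Bool} {k : ℕ} : ∀ {e : ℤ} {c : ℕ},
    Cost (E i) (e + sgn ε * k) c → O E (some (i, e)) (List.replicate k (i, ε)) c := by
  induction k with
  | zero =>
    intro e c h
    have := O.close i e [] 0 c (O.nil 0) (by simpa using h)
    simpa using this
  | succ k ih =>
    intro e c h
    have := O.step i e ε [] _ 0 c (O.nil 0) (ih (e := e + sgn ε) (c := c) (by
      convert h using 1; push_cast; ring))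
    simpa [List.replicate_succ] using this

lemma O.relator {i : Fin m} {ε : Bool} {k : ℕ} (hk : k ∈ E i) (h0 : k ≠ 0) :
    O E none (List.replicate k (i, ε)) 1 :=
  (O.replicate (Cost.add 0 0 k ε hk h0 Cost.zero)).zero

lemma mk_replicate (i : Fin m) (k : ℕ) (ε : Bool) :
    FreeGroup.mk (List.replicate k (i, ε)) = FreeGroup.of i ^ (sgn ε * k) := by
  induction k with
  | zero => simp [FreeGroup.one_eq_mk]
  | succ k ih =>
    rw [List.replicate_succ, ← List.singleton_append, ← FreeGroup.mul_mk, ih, mk_letter,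
      ← zpow_add]
    congr 1; push_cast; ring

lemma O.ofProd (k : ℕ) : ∀ (g : FreeGroup (Fin m)), IsProdConj (Rel2 m E) k g →
    ∃ w, FreeGroup.mk w = g ∧ O E none w k := by
  induction k with
  | zero =>
    rintro g ⟨r, s, _, h⟩
    exact ⟨[], by simpa [FreeGroup.one_eq_mk] using h.symm, O.nil 0⟩
  | succ k ih =>
    rintro g ⟨r, s, hr, h⟩
    obtain ⟨w, hw1, hw2⟩ := ih _ ⟨fun i => r i.succ, fun i => s i.succ, fun i => hr i.succ, rfl⟩
    have hrel : ∃ x, FreeGroup.mk x = r 0 ∧ O E none x 1 := by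
      rcases hr 0 with ⟨i, j, hj, h0, e⟩ | ⟨i, j, hj, h0, e⟩
      · exact ⟨_, by rw [e, mk_replicate i j true]; simp [sgn], O.relator hj h0⟩
      · refine ⟨_, ?_, O.relator (ε := false) hj h0⟩
        rw [mk_replicate, ← inv_inv (r 0), e]; simp [sgn]
    obtain ⟨x, hx1, hx2⟩ := hrel
    refine ⟨(s 0).toWord ++ x ++ (s 0)⁻¹.toWord ++ w, ?_, ?_⟩
    · rw [← FreeGroup.mul_mk, ← FreeGroup.mul_mk, ← FreeGroup.mul_mk, FreeGroup.mk_toWord,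
        FreeGroup.mk_toWord, hx1, hw1, h, List.ofFn_succ, List.prod_cons]
    · exact ((O.conj (by rw [FreeGroup.mk_toWord, FreeGroup.mk_toWord]) hx2).app hw2).mono (by omega)

end Osec

/-! ### Sign-coherent structure -/

/-- `P E x k w n`: the word `w` consists of `k` pending letters `x` separated by closed words. -/
inductive P {m : ℕ} (E : Fin m → Set ℕ) : Fin m × Bool → ℕ → Word m → ℕ → Prop
  | nil (x : Fin m × Bool) : P E x 0 [] 0
  | app (x y : Fin m × Bool) (k : ℕ) (s u : Word m) (p q : ℕ) (h : P E x k s p)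
      (h' : P E y 0 u q) : P E x k (s ++ u) (p + q)
  | push (x : Fin m × Bool) (k : ℕ) (s : Word m) (p : ℕ) (h : P E x k s p) :
      P E x (k + 1) (s ++ [x]) p
  | close (x : Fin m × Bool) (k : ℕ) (s : Word m) (p : ℕ) (h : P E x k s p)
      (hk : k ∈ E x.1) (h0 : k ≠ 0) : P E x 0 s (p + 1)
  | conj (y z : Fin m × Bool) (i : Fin m) (ε : Bool) (u : Word m) (q : ℕ) (h : P E y 0 u q) :
      P E z 0 ((i, ε) :: u ++ [(i, !ε)]) q

section Psec
variable {m : ℕ} {E : Fin m → Set ℕ}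

lemma P.len {x : Fin m × Bool} {k n : ℕ} {w : Word m} (h : P E x k w n) : k + n ≤ w.length := by
  induction h with
  | nil x => simp
  | app x y k s u p q _ _ ih1 ih2 => simp; omega
  | push x k s p _ ih => simp; omega
  | close x k s p _ hk h0 ih => omega
  | conj y z i ε u q _ ih => simp; omega

lemma P.switch {x y : Fin m × Bool} {n : ℕ} {w : Word m} (h : P E x 0 w n) : P E y 0 w n := by
  simpa using P.app y x 0 [] w 0 n (P.nil y) h

lemma P.last {x : Fin m × Bool} {k n : ℕ} {w : Word m} (h : P E x k w n) :
    ∀ {k' : ℕ}, k = k' + 1 → ∃ s u p q, w = s ++ x :: u ∧ n = p + q ∧ P E x k' s p ∧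
      P E x 0 u q := by
  induction h with
  | nil x => intro k' h; omega
  | app x y k s u p q _ h2 ih1 _ =>
    intro k' hk
    obtain ⟨s', u', p', q', rfl, rfl, h3, h4⟩ := ih1 hk
    exact ⟨s', u' ++ u, p', q' + q, by simp, by omega, h3, P.app _ _ _ _ _ _ _ h4 h2⟩
  | push x k s p h ih =>
    intro k' hk
    obtain rfl : k = k' := by omega
    exact ⟨s, [], p, 0, by simp, by omega, h, P.nil x⟩
  | close x k s p _ hk h0 ih => intro k' h; omega
  | conj y z i ε u q _ ih => intro k' h; omega

lemma P.cancel {i : Fin m} {ε : Bool} {k n : ℕ} {w : Word m} (h : P E (i, ε) (k + 1) w n) :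
    P E (i, ε) k (w ++ [(i, !ε)]) n := by
  obtain ⟨s, u, p, q, rfl, rfl, h3, h4⟩ := h.last rfl
  have := P.app _ _ _ _ _ _ _ h3 (P.conj _ (i, ε) i ε u q h4)
  simpa using this

lemma P.split {x : Fin m × Bool} {k1 k2 : ℕ} : ∀ {n : ℕ} {w : Word m}, P E x (k1 + k2) w n →
    ∃ s u p q, w = s ++ u ∧ n = p + q ∧ P E x k1 s p ∧ P E x k2 u q := by
  induction k2 with
  | zero => intro n w h; exact ⟨w, [], n, 0, by simp, by simp, h, P.nil x⟩
  | succ k ih =>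
    intro n w h
    obtain ⟨s, u, p, q, rfl, rfl, h3, h4⟩ := h.last rfl
    obtain ⟨s', u', p', q', rfl, rfl, h5, h6⟩ := ih h3
    refine ⟨s', u' ++ x :: u, p', q' + q, by simp, by omega, h5, ?_⟩
    have := P.app _ _ _ _ _ _ _ (P.push _ _ _ _ h6) h4
    simpa using this

lemma P.closeMany {x : Fin m × Bool} {a t : ℕ} (ha : a ∈ E x.1) (h0 : a ≠ 0) :
    ∀ {n : ℕ} {w : Word m}, P E x (t * a) w n → P E x 0 w (n + t) := by
  induction t with
  | zero => intro n w h; simpa using h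
  | succ t ih =>
    intro n w h
    rw [add_mul, one_mul] at h
    obtain ⟨s, u, p, q, rfl, rfl, h3, h4⟩ := h.split
    have := P.app _ _ _ _ _ _ _ (ih h3) (P.close _ _ _ _ h4 ha h0)
    convert this using 1
    omega

lemma cost_single {a : ℕ} {e : ℤ} {c : ℕ} (h : Cost {a} e c) :
    ∃ t : ℤ, e = t * a ∧ t.natAbs ≤ c := by
  induction h with
  | zero => exact ⟨0, by simp, by simp⟩
  | add e c k δ hk h0 _ ih =>
    obtain ⟨t, rfl, ht⟩ := ih
    obtain rfl : k = a := hk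
    refine ⟨t + sgn δ, by ring, ?_⟩
    rcases sgn_cases δ with h | h <;> rw [h] <;> omega

lemma cost_mult {a : ℕ} {e : ℤ} {c : ℕ} (h : Cost {k | ∃ t : ℕ, 1 ≤ t ∧ k = t * a} e c) :
    ∃ t : ℤ, e = t * a ∧ (c = 0 → t = 0) := by
  induction h with
  | zero => exact ⟨0, by simp, by simp⟩
  | add e c k δ hk h0 _ ih =>
    obtain ⟨t, rfl, ht⟩ := ih
    obtain ⟨r, _, rfl⟩ := hk
    exact ⟨t + sgn δ * r, by push_cast; ring, by simp⟩

lemma P.closeCost {i : Fin m} {ε : Bool} {k n c : ℕ} {w : Word m}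
    (hE : E i = {0} ∨ ∃ n : ℕ, 0 < n ∧ (E i = {n} ∨ E i = {k | ∃ t : ℕ, 1 ≤ t ∧ k = t * n}))
    (h : P E (i, ε) k w n) (hc : Cost (E i) (sgn ε * k) c) :
    ∃ n' ≤ n + c, P E (i, ε) 0 w n' := by
  have habs : (sgn ε * (k : ℤ)).natAbs = k := by
    rcases sgn_cases ε with h | h <;> rw [h] <;> omega
  rcases hE with h0 | ⟨a, ha, h1 | h1⟩
  · rw [h0] at hc
    obtain ⟨t, ht, _⟩ := cost_single hc
    rw [ht] at habs
    simp at habs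
    subst habs
    exact ⟨n, by omega, h⟩
  · rw [h1] at hc
    obtain ⟨t, ht, htc⟩ := cost_single hc
    rw [ht, Int.natAbs_mul, Int.natAbs_natCast] at habs
    subst habs
    exact ⟨_, by omega, P.closeMany (by rw [h1]; rfl) (by omega) h⟩
  · rw [h1] at hc
    obtain ⟨t, ht, htc⟩ := cost_mult hc
    rw [ht, Int.natAbs_mul, Int.natAbs_natCast] at habs
    by_cases hk : k = 0
    · subst hk; exact ⟨n, by omega, h⟩
    · have ht0 : t ≠ 0 := by
        rintro rfl; simp at habs; omega
      refine ⟨n + 1, ?_, P.close _ _ _ _ h ?_ hk⟩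
      · by_contra hcon
        exact ht0 (htc (by omega))
      · rw [h1]; exact ⟨t.natAbs, by omega, habs.symm⟩

lemma O.toP (hE : ∀ i, E i = {0} ∨ ∃ n : ℕ, 0 < n ∧
      (E i = {n} ∨ E i = {k | ∃ t : ℕ, 1 ≤ t ∧ k = t * n}))
    {st : Option (Fin m × ℤ)} {w : Word m} {n : ℕ} (h : O E st w n) :
    (st = none → ∀ y, ∃ n' ≤ n, P E y 0 w n') ∧
    (∀ (i : Fin m) (e : ℤ), st = some (i, e) → ∀ (ε : Bool) (k : ℕ) (s : Word m) (p : ℕ),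
      e = sgn ε * k → P E (i, ε) k s p → ∃ n' ≤ p + n, P E (i, ε) 0 (s ++ w) n') := by
  induction h with
  | nil n => exact ⟨fun _ y => ⟨0, by omega, P.nil y⟩, fun i e h => by simp at h⟩
  | opn i ε w n _ ih =>
    refine ⟨fun _ y => ?_, fun i e h => by simp at h⟩
    obtain ⟨n', h1, h2⟩ := ih.2 i _ rfl ε 1 [(i, ε)] 0 (by simp)
      (by simpa using P.push _ _ _ _ (P.nil (i, ε)))
    exact ⟨n', by omega, h2.switch⟩
  | close i e w n c _ hc ih =>
    refine ⟨fun h => by simp at h, ?_⟩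
    rintro _ _ ⟨⟩ ε k s p rfl hs
    obtain ⟨a, ha, ha'⟩ := ih.1 rfl (i, ε)
    obtain ⟨b, hb, hb'⟩ := hs.closeCost (hE i) hc
    exact ⟨b + a, by omega, P.app _ _ _ _ _ _ _ hb' ha'⟩
  | step i e ε u w p q _ _ ih1 ih2 =>
    refine ⟨fun h => by simp at h, ?_⟩
    rintro _ _ ⟨⟩ δ k s r rfl hs
    obtain ⟨a, ha, ha'⟩ := ih1.1 rfl (i, ε)
    have h1 := P.app _ _ _ _ _ _ _ hs ha'
    by_cases hδ : ε = δ
    · subst hδ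
      obtain ⟨n', h2, h3⟩ := ih2.2 i _ rfl ε (k + 1) _ _ (by push_cast; ring) (P.push _ _ _ _ h1)
      exact ⟨n', by omega, by simpa using h3⟩
    · obtain rfl : ε = !δ := by cases ε <;> cases δ <;> simp_all
      cases k with
      | zero =>
        obtain ⟨n', h2, h3⟩ := ih2.2 i _ rfl (!δ) 1 _ _ (by simp)
          (P.push _ _ _ _ (h1.switch (y := (i, !δ))))
        exact ⟨n', by omega, by simpa using h3.switch (y := (i, δ))⟩
      | succ k =>
        obtain ⟨n', h2, h3⟩ := ih2.2 i _ rfl δ k _ _ (by rw [sgn_not]; push_cast; ring)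
          h1.cancel
        exact ⟨n', by omega, by simpa using h3⟩

end Psec

/-! ### Scheduling -/

/-- Chains of elementary operations with at most `N` pseudobrackets. -/
inductive Ch (m : ℕ) (E : Fin m → Set ℕ) (W : Word m) (N : ℕ) (A : Finset PB) :
    Finset PB → ℕ → Prop
  | refl (h : A.card ≤ N) : Ch m E W N A A 0
  | tail (B C : Finset PB) (s : ℕ) (h : Ch m E W N A B s) (hs : Step m E W B C)
      (hC : C.card ≤ N) : Ch m E W N A C (s + 1)

section Chsec
variable {m : ℕ} {E : Fin m → Set ℕ} {W : Word m}

lemma Ch.mono {N N' : ℕ} (hN : N ≤ N') {A B : Finset PB} {s : ℕ} (h : Ch m E W N A B s) :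
    Ch m E W N' A B s := by
  induction h with
  | refl h => exact Ch.refl (h.trans hN)
  | tail B C s _ hs hC ih => exact Ch.tail B C s ih hs (hC.trans hN)

lemma Ch.trans {N : ℕ} {A B C : Finset PB} {s t : ℕ} (h : Ch m E W N A B s)
    (h' : Ch m E W N B C t) : Ch m E W N A C (s + t) := by
  induction h' with
  | refl _ => exact h
  | tail C D t _ hs hC ih => exact Ch.tail C D _ ih hs hC

lemma Ch.toSeq {N : ℕ} {A B : Finset PB} {s : ℕ} (h : Ch m E W N A B s) :
    ∃ Bs : ℕ → Finset PB, Bs 0 = A ∧ Bs s = B ∧ (∀ i < s, Step m E W (Bs i) (Bs (i + 1))) ∧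
      ∀ i ≤ s, (Bs i).card ≤ N := by
  induction h with
  | refl h => exact ⟨fun _ => A, rfl, rfl, fun i hi => by omega, fun _ _ => h⟩
  | tail B C s _ hs hC ih =>
    obtain ⟨Bs, h0, h1, h2, h3⟩ := ih
    refine ⟨fun i => if i ≤ s then Bs i else C, by simpa using h0, by simp, ?_, ?_⟩
    · intro i hi
      rcases Nat.lt_or_ge i s with h | h
      · simpa [h.le, Nat.succ_le_of_lt h] using h2 i h
      · obtain rfl : i = s := by omega
        simpa [h1] using hs
    · intro i hi
      by_cases h : i ≤ s
      · simpa [h] using h3 i h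
      · simpa [h] using hC

/-- A unary elementary operation. -/
def Un (m : ℕ) (E : Fin m → Set ℕ) (W : Word m) (b b' : PB) : Prop :=
  ∀ B : Finset PB, b ∈ B → IsPBS m E W (insert b' (B.erase b)) →
    Step m E W B (insert b' (B.erase b))

/-- Binary derivation trees of pseudobrackets, with the number of leaves and of operations. -/
inductive Tr (m : ℕ) (E : Fin m → Set ℕ) (W : Word m) : PB → ℕ → ℕ → Prop
  | start (v : ℕ) (hv : v ≤ W.length) : Tr m E W ⟨v, v, 0, 0, 0, 0⟩ 1 1
  | un (b b' : PB) (L S : ℕ) (h : Tr m E W b L S) (hu : Un m E W b b')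
      (hv : ValidPB m E W b') (h1 : b'.c1 ≤ b.c1) (h2 : b.c2 ≤ b'.c2) : Tr m E W b' L (S + 1)
  | merge (b c b' : PB) (L S L' S' : ℕ) (h : Tr m E W b L S) (h' : Tr m E W c L' S')
      (hb : b.c1 < b.c2) (hc : c.c1 < c.c2) (hr : b.c2 = c.c1) (h1 : IsPB1 b ∨ IsPB1 c)
      (hb' : b' = ⟨b.c1, c.c2, b.c3 + c.c3, b.c4 + c.c4, b.c5 + c.c5, b.c6 + c.c6⟩)
      (hv : ValidPB m E W b') : Tr m E W b' (L + L') (S + S' + 1)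

lemma Tr.pos {b : PB} {L S : ℕ} (h : Tr m E W b L S) : 1 ≤ L := by
  induction h with
  | start => omega
  | un => assumption
  | merge => omega

lemma Tr.valid {b : PB} {L S : ℕ} (h : Tr m E W b L S) : ValidPB m E W b := by
  induction h with
  | start v hv => exact ⟨le_rfl, hv, Nat.zero_le _, Or.inl ⟨rfl, rfl, rfl⟩⟩
  | un => assumption
  | merge => assumption

/-- A context in which the pseudobracket `b` may be created. -/
def Ctx (m : ℕ) (E : Fin m → Set ℕ) (W : Word m) (B : Finset PB) (b : PB) : Prop :=
  IsPBS m E W B ∧ ∀ c ∈ B, c.c1 < c.c2 ∧ (c.c2 ≤ b.c1 ∨ b.c2 ≤ c.c1)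

lemma Ctx.pbs {B : Finset PB} {b : PB} (h : Ctx m E W B b) (hv : ValidPB m E W b) :
    IsPBS m E W (insert b B) := by
  refine ⟨fun c hc => ?_, fun c hc d hd hcd => ?_⟩
  · rcases Finset.mem_insert.1 hc with rfl | hc
    · exact hv
    · exact h.1.1 c hc
  · rcases Finset.mem_insert.1 hc with hc1 | hc1 <;>
      rcases Finset.mem_insert.1 hd with hd1 | hd1
    · exact absurd (hc1.trans hd1.symm) hcd
    · rw [hc1]; exact (h.2 d hd1).2.symm
    · rw [hd1]; exact (h.2 c hc1).2
    · exact h.1.2 c hc1 d hd1 hcd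

lemma Ctx.notMem {B : Finset PB} {b : PB} (h : Ctx m E W B b) : b ∉ B := by
  intro hb
  have := h.2 b hb
  omega

lemma Ctx.shrink {B : Finset PB} {b b' : PB} (h : Ctx m E W B b') (h1 : b'.c1 ≤ b.c1)
    (h2 : b.c2 ≤ b'.c2) : Ctx m E W B b :=
  ⟨h.1, fun c hc => ⟨(h.2 c hc).1, by have := (h.2 c hc).2; omega⟩⟩

lemma Ctx.ins {B : Finset PB} {b c : PB} (h : Ctx m E W B b) (h' : Ctx m E W B c)
    (hv : ValidPB m E W b) (hb : b.c1 < b.c2) (hbc : b.c2 ≤ c.c1 ∨ c.c2 ≤ b.c1) :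
    Ctx m E W (insert b B) c := by
  refine ⟨h.pbs hv, fun d hd => ?_⟩
  rcases Finset.mem_insert.1 hd with rfl | hd
  · exact ⟨hb, hbc⟩
  · exact h'.2 d hd

lemma log_half {a b : ℕ} (h : a ≤ b) (ha : 1 ≤ a) : 1 + Nat.log 2 a ≤ Nat.log 2 (b + a) := by
  have h1 : Nat.log 2 (a * 2) = Nat.log 2 a + 1 := Nat.log_mul_base (by norm_num) (by omega)
  have h2 : Nat.log 2 (a * 2) ≤ Nat.log 2 (b + a) := Nat.log_mono_right (by omega)
  omega

lemma Tr.schedule {b : PB} {L S : ℕ} (h : Tr m E W b L S) : ∀ B : Finset PB, Ctx m E W B b →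
    Ch m E W (B.card + 1 + Nat.log 2 L) B (insert b B) S := by
  induction h with
  | start v hv =>
    intro B hB
    refine Ch.tail B _ 0 (Ch.refl (by omega)) (Step.add B v hv hB.notMem (hB.pbs ?_)) ?_
    · exact (Tr.start v hv).valid
    · exact (Finset.card_insert_le _ _).trans (by omega)
  | un b b' L S h hu hv h1 h2 ih =>
    intro B hB
    have hB' := hB.shrink h1 h2
    have he : (insert b B).erase b = B := Finset.erase_insert hB'.notMem
    refine Ch.tail _ _ _ (ih B hB') ?_ ((Finset.card_insert_le _ _).trans (by omega))
    have := hu (insert b B) (Finset.mem_insert_self _ _) (by rw [he]; exact hB.pbs hv)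
    rwa [he] at this
  | merge b c b' L S L' S' h h' hb hc hr h1 hb' hv ih1 ih2 =>
    intro B hB
    have e1 : b'.c1 = b.c1 := by rw [hb']
    have e2 : b'.c2 = c.c2 := by rw [hb']
    have hBb : Ctx m E W B b := hB.shrink (by omega) (by omega)
    have hBc : Ctx m E W B c := hB.shrink (by omega) (by omega)
    have hbc : Ctx m E W (insert b B) c := hBb.ins hBc h.valid hb (by omega)
    have hcb : Ctx m E W (insert c B) b := hBc.ins hBb h'.valid hc (by omega)
    have hL := h.pos
    have hL' := h'.pos
    have hne : b ≠ c := by rintro rfl; omega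
    have key : Ch m E W (B.card + 1 + Nat.log 2 (L + L')) B (insert c (insert b B)) (S + S') := by
      rcases Nat.le_total L' L with hle | hle
      · refine Ch.trans ((ih1 B hBb).mono ?_) ((ih2 _ hbc).mono ?_)
        · have : Nat.log 2 L ≤ Nat.log 2 (L + L') := Nat.log_mono_right (by omega)
          omega
        · have := log_half hle hL'
          have := Finset.card_insert_le b B
          omega
      · rw [Finset.insert_comm, add_comm S]
        refine Ch.trans ((ih2 B hBc).mono ?_) ((ih1 _ hcb).mono ?_)
        · have : Nat.log 2 L' ≤ Nat.log 2 (L + L') := Nat.log_mono_right (by omega)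
          omega
        · have := log_half hle hL
          rw [add_comm L']  at this
          have := Finset.card_insert_le c B
          omega
    have he : ((insert c (insert b B)).erase b).erase c = B := by
      rw [Finset.insert_comm, Finset.erase_insert hcb.notMem, Finset.erase_insert hBc.notMem]
    refine Ch.tail _ _ _ key ?_ ((Finset.card_insert_le _ _).trans (by omega))
    have := Step.merge (m := m) (E := E) (W := W) (insert c (insert b B)) b c b'
      (by simp) (by simp) hne hr h1 hb' (by rw [he]; exact hB.pbs hv)
    rwa [he] at this

/-! ### Building the trees -/

/-- Turn followed by a right extension, or a right extension. -/
lemma Tr.extR {p q k K n L S : ℕ} {i : Fin m} {ε : Bool} (hK : K ∈ E i) (hKW : K ≤ W.length)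
    (hkK : k < K) (hlet : W[q]? = some (i, ε)) (hn : n + 1 ≤ W.length) (hpq : p ≤ q)
    (h : Tr m E W ⟨p, q, (i : ℕ) + 1, K, sgn ε * k, n⟩ L S) :
    (k + 1 < K → Tr m E W ⟨p, q + 1, (i : ℕ) + 1, K, sgn ε * (k + 1 : ℕ), n⟩ L (S + 1)) ∧
    (k + 1 = K → Tr m E W ⟨p, q + 1, 0, 0, 0, n + 1⟩ L (S + 1)) := by
  have hq : q < W.length := by
    by_contra hcon
    rw [List.getElem?_eq_none (by omega)] at hlet
    simp at hlet
  have habs : (sgn ε * (k : ℤ)).natAbs = k := by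
    rcases sgn_cases ε with h | h <;> rw [h] <;> omega
  have hsg : 0 ≤ sgn ε * (sgn ε * (k : ℤ)) := by
    rcases sgn_cases ε with h | h <;> rw [h] <;> omega
  constructor
  · intro hk
    refine Tr.un _ _ L S h (fun B hb hpbs => ?_) ?_ le_rfl (by simp)
    · refine Step.ext1R B _ _ hb i ε rfl hlet ?_ hsg ?_ hpbs
      · simp only [habs]; omega
      · simp only [PB.mk.injEq, true_and, and_true]; push_cast; ring
    · refine ⟨by simp only; omega, by simp only; omega, by simp only; omega, Or.inr ⟨i, rfl, hK,
        by simp only; omega, hKW, ?_, ?_⟩⟩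
      · rcases sgn_cases ε with h | h <;> simp only [h] <;> omega
      · rcases sgn_cases ε with h | h <;> simp only [h] <;> omega
  · intro hk
    refine Tr.un _ _ L S h (fun B hb hpbs => ?_) ?_ le_rfl (by simp)
    · refine Step.ext2R B _ _ hb i ε rfl hlet ?_ hsg rfl hpbs
      simp only [habs]; omega
    · exact ⟨by simp only; omega, by simp only; omega, by simp only; omega,
        Or.inl ⟨rfl, rfl, rfl⟩⟩

lemma Tr.turn {p q K n L S : ℕ} {i : Fin m} (hK : K ∈ E i) (hKW : K ≤ W.length)
    (hK0 : 0 < K) (h : Tr m E W ⟨p, q, 0, 0, 0, n⟩ L S) :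
    Tr m E W ⟨p, q, (i : ℕ) + 1, K, 0, n⟩ L (S + 1) := by
  refine Tr.un _ _ L S h (fun B hb hpbs => ?_) ?_ le_rfl le_rfl
  · refine Step.turn B _ _ hb ⟨rfl, rfl, rfl⟩ i ?_ K hK hK0 hKW rfl hpbs
    intro hE
    rw [hE] at hK
    have : K = 0 := hK
    omega
  · obtain ⟨h1, h2, h3, _⟩ := h.valid
    exact ⟨h1, h2, h3, Or.inr ⟨i, rfl, hK, hK0, hKW, by simp only; omega, by simp only; omega⟩⟩

/-- The pseudobracket for `P E x k w n` aiming at exponent `K`. -/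
def tgt {m : ℕ} (x : Fin m × Bool) (K k p q n : ℕ) : PB :=
  if k = 0 then ⟨p, q, 0, 0, 0, n⟩
  else if k < K then ⟨p, q, (x.1 : ℕ) + 1, K, sgn x.2 * k, n⟩
  else ⟨p, q, 0, 0, 0, n + 1⟩

/-- Tree of linear size. -/
def Good (m : ℕ) (E : Fin m → Set ℕ) (W : Word m) (b : PB) (len : ℕ) : Prop :=
  ∃ L S, Tr m E W b L S ∧ L ≤ len ∧ S + 1 ≤ 11 * len

lemma Good.mergeTgt {x : Fin m × Bool} {K k p q r n n' l l' : ℕ}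
    (hlt : p < q) (hlt' : q < r) (hn : n + n' + 1 ≤ W.length ∨ k = 0 ∧ n + n' ≤ W.length)
    (h : Good m E W (tgt x K k p q n) l)
    (h' : Good m E W ⟨q, r, 0, 0, 0, n'⟩ l') :
    Good m E W (tgt x K k p r (n + n')) (l + l') := by
  obtain ⟨L, S, h1, h2, h3⟩ := h
  obtain ⟨L', S', h1', h2', h3'⟩ := h'
  refine ⟨L + L', S + S' + 1, ?_, by omega, by omega⟩
  have hr := h1'.valid.2.1
  have hval := h1.valid.2.2.2
  simp only at hr
  refine Tr.merge _ _ _ _ _ _ _ h1 h1' ?_ hlt' ?_ (Or.inr ⟨rfl, rfl, rfl⟩) ?_ ?_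
  · unfold tgt; split_ifs <;> exact hlt
  · unfold tgt; split_ifs <;> rfl
  · unfold tgt; split_ifs <;> simp; omega
  · unfold tgt at hval ⊢
    split_ifs at hval ⊢ with ha hb
    · exact ⟨by simp only; omega, hr, by simp only; omega, Or.inl ⟨rfl, rfl, rfl⟩⟩
    · exact ⟨by simp only; omega, hr, by simp only; omega, hval⟩
    · exact ⟨by simp only; omega, hr, by simp only; omega, Or.inl ⟨rfl, rfl, rfl⟩⟩

lemma Good.conj {p q n l : ℕ} {i : Fin m} {ε : Bool} (hp : W[p]? = some (i, ε))
    (hq : W[q]? = some (i, !ε)) {L S : ℕ} (h : Tr m E W ⟨p + 1, q, 0, 0, 0, n⟩ L S)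
    (hL : L ≤ l + 1) (hS : S ≤ 11 * l + 5) :
    Good m E W ⟨p, q + 1, 0, 0, 0, n⟩ (l + 2) := by
  have hqW : q < W.length := by
    by_contra hcon
    rw [List.getElem?_eq_none (by omega)] at hq
    simp at hq
  refine ⟨L, S + 1, ?_, by omega, by omega⟩
  obtain ⟨v1, v2, v3, _⟩ := h.valid
  simp only at v1 v2 v3
  refine Tr.un _ _ L S h (fun B hb hpbs => ?_) ?_ (by simp) (by simp)
  · exact Step.ext3 B _ _ hb ⟨rfl, rfl, rfl⟩ i ε (by simp) (by simpa using hp) hq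
      (by simp) hpbs
  · exact ⟨by simp only; omega, by simp only; omega, v3, Or.inl ⟨rfl, rfl, rfl⟩⟩

lemma P.build {x : Fin m × Bool} {k n : ℕ} {w : Word m} (h : P E x k w n) :
    ∀ (s t : Word m), W = s ++ w ++ t → ∀ K, (k = 0 ∨ K ∈ E x.1 ∧ k ≤ K ∧ K ≤ W.length) →
      (w = [] ∧ n = 0 ∧ k = 0) ∨
        Good m E W (tgt x K k s.length (s.length + w.length) n) w.length := by
  induction h with
  | nil x => intro s t _ K _; left; simp
  | app x y k u v p q hu hv ih1 ih2 =>
    intro s t hW K hK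
    have l1 := hu.len
    have l2 := hv.len
    have hlen : W.length = s.length + (u.length + v.length) + t.length := by
      rw [hW]; simp; omega
    rcases ih2 (s ++ u) t (by rw [hW]; simp) K (Or.inl rfl) with ⟨rfl, rfl, _⟩ | g2
    · simpa using ih1 s t (by rw [hW]; simp) K hK
    · have hv0 : v ≠ [] := by
        rintro rfl
        obtain ⟨L, S, h1, h2, h3⟩ := g2
        simp at h3
      have hv1 := List.length_pos_iff.2 hv0
      rcases ih1 s (v ++ t) (by rw [hW]; simp) K hK with ⟨rfl, rfl, rfl⟩ | g1
      · right
        simpa [tgt] using g2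
      · have hu0 : u ≠ [] := by
          rintro rfl
          obtain ⟨L, S, h1, h2, h3⟩ := g1
          simp at h3
        have hu1 := List.length_pos_iff.2 hu0
        right
        have g2' : Good m E W ⟨s.length + u.length, s.length + (u ++ v).length, 0, 0, 0, q⟩
            v.length := by
          simpa [tgt, add_assoc] using g2
        have := g1.mergeTgt (by omega) (by simp; omega) (by omega) g2'
        simpa using this
  | push x k u p hu ih =>
    intro s t hW K hK
    right
    have l1 := hu.len
    have hlen : W.length = s.length + (u.length + 1) + t.length := by
      rw [hW]; simp; omega
    obtain ⟨hK1, hK2, hK3⟩ : K ∈ E x.1 ∧ k + 1 ≤ K ∧ K ≤ W.length := by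
      rcases hK with h | h
      · omega
      · exact h
    have hlet : W[s.length + u.length]? = some (x.1, x.2) := by
      rw [hW]; simp
    have hTr : ∃ L S, Tr m E W ⟨s.length, s.length + u.length, (x.1 : ℕ) + 1, K, sgn x.2 * k, p⟩
        L S ∧ L ≤ u.length + 1 ∧ S + 1 ≤ 11 * u.length + 5 := by
      rcases ih s (x :: t) (by rw [hW]; simp) K (Or.inr ⟨hK1, by omega, hK3⟩) with
        ⟨rfl, rfl, rfl⟩ | ⟨L, S, h1, h2, h3⟩
      · refine ⟨1, 2, ?_, by simp, by simp⟩
        have := Tr.turn hK1 hK3 (by omega) (Tr.start (m := m) (E := E) s.length (by omega))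
        simpa using this
      · by_cases hk : k = 0
        · subst hk
          refine ⟨L, S + 1, ?_, by omega, by omega⟩
          have := Tr.turn hK1 hK3 (by omega) (show Tr m E W ⟨_, _, 0, 0, 0, _⟩ L S from h1)
          simpa using this
        · refine ⟨L, S, ?_, by omega, by omega⟩
          simpa [tgt, hk, show k < K by omega] using h1
    obtain ⟨L, S, h1, h2, h3⟩ := hTr
    have := Tr.extR hK1 hK3 (by omega) hlet (by omega) (by omega) h1
    refine ⟨L, S + 1, ?_, by simpa using h2, by simp; omega⟩
    by_cases hlt : k + 1 < K
    · simpa [tgt, hlt, add_assoc] using this.1 hlt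
    · simpa [tgt, hlt, add_assoc] using this.2 (by omega)
  | close x k u p hu hk h0 ih =>
    intro s t hW K _
    have l1 := hu.len
    have hlen : W.length = s.length + u.length + t.length := by
      rw [hW]; simp; omega
    rcases ih s t hW k (Or.inr ⟨hk, le_rfl, by omega⟩) with ⟨_, _, h⟩ | g
    · exact absurd h h0
    · right
      simpa [tgt, h0] using g
  | conj y z i ε u q hu ih =>
    intro s t hW K _
    right
    have l1 := hu.len
    have hlen : W.length = s.length + (u.length + 2) + t.length := by
      rw [hW]; simp; omega
    have hp : W[s.length]? = some (i, ε) := by rw [hW]; simp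
    have hq : W[s.length + 1 + u.length]? = some (i, !ε) := by
      rw [show W = (s ++ (i, ε) :: u) ++ (i, !ε) :: t by rw [hW]; simp,
        show s.length + 1 + u.length = (s ++ (i, ε) :: u).length by simp; omega]
      simp
    have hTr : ∃ L S, Tr m E W ⟨s.length + 1, s.length + 1 + u.length, 0, 0, 0, q⟩ L S ∧
        L ≤ u.length + 1 ∧ S ≤ 11 * u.length + 5 := by
      rcases ih (s ++ [(i, ε)]) ((i, !ε) :: t) (by rw [hW]; simp) K (Or.inl rfl) with
        ⟨rfl, rfl, _⟩ | ⟨L, S, h1, h2, h3⟩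
      · exact ⟨1, 1, by simpa using Tr.start (m := m) (E := E) (W := W) (s.length + 1) (by omega), by simp, by simp⟩
      · exact ⟨L, S, by simpa [tgt] using h1, by omega, by omega⟩
    obtain ⟨L, S, h1, h2, h3⟩ := hTr
    have := Good.conj hp hq h1 h2 h3
    have e : s.length + ((i, ε) :: u ++ [(i, !ε)]).length = s.length + 1 + u.length + 1 := by
      simp; omega
    rw [e]
    simpa [tgt] using this

end Chsec

lemma final_bound {N : ℕ} (hN : 1 ≤ N) :
    ((1 + Nat.log 2 N : ℕ) : ℝ) ≤ Cconst * (Real.logb 2 (N : ℝ) + 1) := by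
  have h1 : ((Nat.log 2 N : ℕ) : ℝ) ≤ Real.logb 2 N := Real.natLog_le_logb N 2
  have h0 : 0 ≤ Real.logb 2 (N : ℝ) := le_trans (by positivity) h1
  have hC : 1 ≤ Cconst := by
    unfold Cconst
    have hpos : 0 < Real.logb 2 (6 / 5) := Real.logb_pos (by norm_num) (by norm_num)
    have hle : Real.logb 2 (6 / 5) ≤ 1 := by
      rw [Real.logb_le_iff_le_rpow (by norm_num) (by norm_num)]
      norm_num
    exact (one_le_inv₀ hpos).2 hle
  push_cast
  nlinarith

/-- Lemma 4.8: a nonempty word `W` is a product of at most `n` conjugates of words in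
`R_2^{±1}` in `F(A)` iff some sequence of elementary operations transforms the empty
pseudobracket system for `W` into a final pseudobracket system
`{(0, |W|, 0, 0, 0, n')}` with `n' ≤ n`, of size bounded by
`(11|W|, C(log|W| + 1))` where `C = (log (6/5))⁻¹`. -/
theorem statement11 (m : ℕ) (E : Fin m → Set ℕ)
    (hE : ∀ i, E i = {0} ∨ ∃ n : ℕ, 0 < n ∧
      (E i = {n} ∨ E i = {k | ∃ t : ℕ, 1 ≤ t ∧ k = t * n}))
    (W : Word m) (hW : W ≠ []) (n : ℕ) :
    (∃ k ≤ n, IsProdConj (Rel2 m E) k (evalW W)) ↔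
    ∃ (ℓ : ℕ) (Bs : ℕ → Finset PB) (n' : ℕ),
      n' ≤ n ∧
      Bs 0 = ∅ ∧
      Bs ℓ = {(⟨0, W.length, 0, 0, 0, n'⟩ : PB)} ∧
      (∀ i < ℓ, Step m E W (Bs i) (Bs (i + 1))) ∧
      ℓ ≤ 11 * W.length ∧
      (∀ i ≤ ℓ, ((Bs i).card : ℝ) ≤ Cconst * (Real.logb 2 (W.length : ℝ) + 1)) := by
  constructor
  · rintro ⟨k, hk, h⟩
    obtain ⟨w, hw1, hw2⟩ := O.ofProd k _ h
    have hO : O E none W k := O.congr hw1 hw2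
    obtain ⟨x, hx⟩ := List.exists_mem_of_ne_nil W hW
    obtain ⟨n', hn', hP⟩ := (O.toP hE hO).1 rfl x
    have hlen : 1 ≤ W.length := List.length_pos_iff.2 hW
    rcases hP.build (W := W) [] [] (by simp) 0 (Or.inl rfl) with ⟨h0, _⟩ | ⟨L, S, h1, h2, h3⟩
    · exact absurd h0 hW
    · have h4 := h1.schedule ∅ ⟨⟨by simp, by simp⟩, by simp⟩
      obtain ⟨Bs, b0, b1, b2, b3⟩ := h4.toSeq
      refine ⟨S, Bs, n', by omega, b0, by rw [b1]; simp [tgt], b2, by omega, fun i hi => ?_⟩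
      refine le_trans ?_ (final_bound hlen)
      have h5 : Nat.log 2 L ≤ Nat.log 2 W.length := Nat.log_mono_right h2
      have h6 := b3 i hi
      simp only [Finset.card_empty] at h6
      exact_mod_cast (by omega : (Bs i).card ≤ 1 + Nat.log 2 W.length)
  · rintro ⟨ℓ, Bs, n', hn', b0, b1, b2, _, _⟩
    have key : ∀ i ≤ ℓ, ∀ b ∈ Bs i, ValidPB m E W b ∧ Inv E W b := by
      intro i
      induction i with
      | zero => intro _ b hb; rw [b0] at hb; simp at hb
      | succ i ih => intro hi; exact (b2 i (by omega)).inv (ih (by omega))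
    have h1 := (key ℓ le_rfl _ (by rw [b1]; exact Finset.mem_singleton_self _)).2.1
      ⟨rfl, rfl, rfl⟩
    have h2 : PC (Rel2 m E) n' (evalW W) := by
      have e : (pre W 0)⁻¹ * pre W W.length = evalW W := by
        simp [pre, evalW, ← FreeGroup.one_eq_mk]
      rw [← e]; exact h1
    exact (h2.mono hn').to

end Stmt11
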